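/- arXiv:1812.11368 — 12 statements merged into one kernel-verified Lean document; each statement's English description precedes it below -/
import Mathlib

section
/- Let α ∈ (0,1), let a be an integer, let m be a positive integer, and let x : ℤ → ℝ. Then for every integer k ≥ a, ᶜ∇ᵃ_k^α (x^{2m}) ≤ 2·x(k)^m · ᶜ∇ᵃ_k^α (x^m), where x^p denotes the function j ↦ x(j)^p. -/
noncomputable def nablaCaputo (α : ℝ) (a : ℤ) (f : ℤ → ℝ) (k : ℤ) : ℝ :=
  ∑ j ∈ Finset.Icc a k,
    Real.Gamma (((k - j : ℤ) : ℝ) + 1 - α) /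
      (Real.Gamma (1 - α) * Real.Gamma (((k - j : ℤ) : ℝ) + 1)) * (f j - f (j - 1))

/-- Abel summation bound for a nonnegative sequence against nondecreasing weights. -/
theorem sum_mul_sub_le_of_monotone_weights {a k : ℤ} (hk : a ≤ k) {w z : ℤ → ℝ}
    (ha : 0 ≤ w a) (hw : ∀ j, a ≤ j → j < k → w j ≤ w (j + 1)) (hz : ∀ j, 0 ≤ z j) :
    ∑ j ∈ Finset.Icc a k, w j * (z j - z (j - 1)) ≤ w k * z k := by
  induction k, hk using Int.leInduction with
  | base =>
    simp only [Finset.Icc_self, Finset.sum_singleton]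
    nlinarith [mul_nonneg ha (hz (a - 1))]
  | succ n hn ih =>
    have hIcc : Finset.Icc a (n + 1) = insert (n + 1) (Finset.Icc a n) := by
      ext j
      simp only [Finset.mem_Icc, Finset.mem_insert]
      omega
    have hsum := ih fun j haj hjn => hw j haj (by omega)
    rw [hIcc, Finset.sum_insert (by simp), add_sub_cancel_right]
    nlinarith [mul_le_mul_of_nonneg_right (hw n hn (by omega)) (hz n)]

theorem caputo_weight_add_one_le {α t : ℝ} (hα0 : 0 < α) (hα1 : α < 1) (ht : 0 ≤ t) :
    Real.Gamma (t + 1 + 1 - α) / (Real.Gamma (1 - α) * Real.Gamma (t + 1 + 1)) ≤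
      Real.Gamma (t + 1 - α) / (Real.Gamma (1 - α) * Real.Gamma (t + 1)) := by
  have ht1 : 0 < t + 1 := by linarith
  have hs : 0 < t + 1 - α := by linarith
  have hA : 0 < Real.Gamma (1 - α) := Real.Gamma_pos_of_pos (by linarith)
  have hB : 0 < Real.Gamma (t + 1) := Real.Gamma_pos_of_pos ht1
  have hC : 0 < Real.Gamma (t + 1 - α) := Real.Gamma_pos_of_pos hs
  have hnum : t + 1 + 1 - α = t + 1 - α + 1 := by ring
  rw [hnum, Real.Gamma_add_one hs.ne',
    Real.Gamma_add_one ht1.ne', div_le_div_iff₀ (by positivity) (by positivity)]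
  nlinarith [mul_pos (mul_pos (mul_pos hA hB) hC) hα0]

theorem nablaC_pow_two_mul (α : ℝ) (hα0 : 0 < α) (hα1 : α < 1) (a : ℤ)
    (m : ℕ) (hm : 0 < m) (x : ℤ → ℝ) (k : ℤ) (hk : a ≤ k) :
    nablaCaputo α a (fun j => x j ^ (2 * m)) k ≤ 2 * x k ^ m * nablaCaputo α a (fun j => x j ^ m) k := by
  have h := sum_mul_sub_le_of_monotone_weights hk
    (w := fun j => Real.Gamma (((k - j : ℤ) : ℝ) + 1 - α) /
      (Real.Gamma (1 - α) * Real.Gamma (((k - j : ℤ) : ℝ) + 1)))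
    (z := fun j => (x j ^ m - x k ^ m) ^ 2) ?_ ?_ fun j => sq_nonneg _
  · simp only [sub_self, ne_eq, OfNat.ofNat_ne_zero, not_false_eq_true, zero_pow, mul_zero] at h
    rw [← sub_nonpos]
    refine le_of_eq_of_le ?_ h
    unfold nablaCaputo
    rw [Finset.mul_sum, ← Finset.sum_sub_distrib]
    exact Finset.sum_congr rfl fun j _ => by ring
  · have hka : (0 : ℝ) ≤ ((k - a : ℤ) : ℝ) := by exact_mod_cast sub_nonneg.2 hk
    exact div_nonneg (Real.Gamma_nonneg_of_nonneg (by linarith))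
      (mul_nonneg (Real.Gamma_nonneg_of_nonneg (by linarith))
        (Real.Gamma_nonneg_of_nonneg (by linarith)))
  · intro j _ hjk
    have ht : (0 : ℝ) ≤ ((k - (j + 1) : ℤ) : ℝ) := by exact_mod_cast (by omega : 0 ≤ k - (j + 1))
    have hkj : ((k - j : ℤ) : ℝ) = ((k - (j + 1) : ℤ) : ℝ) + 1 := by push_cast; ring
    simp only [hkj]
    exact caputo_weight_add_one_le hα0 hα1 ht
end

section
/- Let α ∈ (0,1), let a be an integer, let m, n be positive integers with 2m > n, and let x : ℤ → ℝ. Then for every integer k ≥ a, ᶜ∇ᵃ_k^α (x^{2m}) ≤ (2m/(2m−n)) · x(k)^n · ᶜ∇ᵃ_k^α (x^{2m−n}), where x^p denotes the function j ↦ x(j)^p. -/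
/-- One-sided summation by parts: against nondecreasing weights, a nonnegative sequence has
backward differences bounded below by its boundary term. -/
theorem neg_mul_le_sum_Icc_mul_sub (c G : ℤ → ℝ) (a k : ℤ) (hk : a ≤ k) (hG : ∀ j, 0 ≤ G j)
    (ha : 0 ≤ c a) (hc : ∀ j, a ≤ j → j < k → c j ≤ c (j + 1)) :
    -(c k * G k) ≤ ∑ j ∈ Finset.Icc a k, c j * (G (j - 1) - G j) := by
  induction k, hk using Int.leInduction with
  | base =>
    rw [Finset.Icc_self, Finset.sum_singleton]
    nlinarith [mul_nonneg ha (hG (a - 1))]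
  | succ k hk ih =>
    have hprev := ih fun j h₁ h₂ => hc j h₁ (by lia)
    have hIcc : Finset.Icc a (k + 1) = insert (k + 1) (Finset.Icc a k) := by
      ext j
      simp only [Finset.mem_insert, Finset.mem_Icc]
      lia
    rw [hIcc, Finset.sum_insert (by simp), add_sub_cancel_right]
    nlinarith [mul_le_mul_of_nonneg_right (hc k hk (by lia)) (hG k)]

/-- Weighted AM-GM for integer powers with even total exponent, with no sign condition. -/
theorem mul_pow_mul_pow_sub_le (N n : ℕ) (hN : Even N) (hn : n < N) (y t : ℝ) :
    (N : ℝ) * (y ^ n * t ^ (N - n)) ≤ n * y ^ N + ((N : ℝ) - n) * t ^ N := by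
  have hN0 : (0 : ℝ) < N := by exact_mod_cast (Nat.zero_le n).trans_lt hn
  have hnN : (n : ℝ) ≤ N := by exact_mod_cast hn.le
  have hpow (z : ℝ) (p : ℕ) : (|z| ^ N) ^ ((p : ℝ) / N) = |z| ^ p := by
    rw [← Real.rpow_natCast, ← Real.rpow_mul (abs_nonneg z), mul_div_cancel₀ _ hN0.ne',
      Real.rpow_natCast]
  have h := Real.geom_mean_le_arith_mean2_weighted (w₁ := n / N) (w₂ := (N - n : ℕ) / N)
    (p₁ := |y| ^ N) (p₂ := |t| ^ N) (by positivity) (by positivity) (by positivity)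
    (by positivity) (by rw [Nat.cast_sub hn.le]; field_simp; ring)
  rw [hpow, hpow, hN.pow_abs, hN.pow_abs, Nat.cast_sub hn.le] at h
  calc (N : ℝ) * (y ^ n * t ^ (N - n)) ≤ N * (|y| ^ n * |t| ^ (N - n)) := by
        rw [← abs_pow, ← abs_pow, ← abs_mul]
        exact mul_le_mul_of_nonneg_left (le_abs_self _) hN0.le
    _ ≤ N * (n / N * y ^ N + ((N : ℝ) - n) / N * t ^ N) := by gcongr
    _ = n * y ^ N + ((N : ℝ) - n) * t ^ N := by field_simp

theorem Gamma_div_Gamma_add_one_le {α s : ℝ} (hα0 : 0 ≤ α) (hα1 : α < 1) (hs : 0 ≤ s) :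
    Real.Gamma (s + 1 + 1 - α) / (Real.Gamma (1 - α) * Real.Gamma (s + 1 + 1)) ≤
      Real.Gamma (s + 1 - α) / (Real.Gamma (1 - α) * Real.Gamma (s + 1)) := by
  have h₁ : 0 < Real.Gamma (1 - α) := Real.Gamma_pos_of_pos (by linarith)
  have h₂ : 0 < Real.Gamma (s + 1) := Real.Gamma_pos_of_pos (by linarith)
  have h₃ : 0 < Real.Gamma (s + 1 - α) := Real.Gamma_pos_of_pos (by linarith)
  rw [show s + 1 + 1 - α = (s + 1 - α) + 1 by ring,
    Real.Gamma_add_one (s := s + 1 - α) (by linarith),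
    Real.Gamma_add_one (s := s + 1) (by linarith), div_le_div_iff₀ (by positivity) (by positivity)]
  have h : 0 ≤ α * (Real.Gamma (s + 1 - α) * Real.Gamma (1 - α) * Real.Gamma (s + 1)) := by
    positivity
  linarith

theorem nablaCaputo_nonneg_of_le {α : ℝ} (hα0 : 0 ≤ α) (hα1 : α < 1) {a k : ℤ} (hk : a ≤ k)
    {f : ℤ → ℝ} (hf : ∀ j, f j ≤ f k) : 0 ≤ nablaCaputo α a f k := by
  have h := neg_mul_le_sum_Icc_mul_sub
    (fun j => Real.Gamma (((k - j : ℤ) : ℝ) + 1 - α) /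
      (Real.Gamma (1 - α) * Real.Gamma (((k - j : ℤ) : ℝ) + 1)))
    (fun j => f k - f j) a k hk (fun j => sub_nonneg.2 (hf j)) ?_ ?_
  · simpa [nablaCaputo] using h
  · have hs : (0 : ℝ) ≤ ((k - a : ℤ) : ℝ) := by exact_mod_cast sub_nonneg.2 hk
    exact div_nonneg (Real.Gamma_nonneg_of_nonneg (by linarith))
      (mul_nonneg (Real.Gamma_nonneg_of_nonneg (by linarith))
        (Real.Gamma_nonneg_of_nonneg (by linarith)))
  · intro j _ hj
    have hs : (0 : ℝ) ≤ ((k - (j + 1) : ℤ) : ℝ) := by exact_mod_cast (by lia : 0 ≤ k - (j + 1))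
    have hcast : ((k - j : ℤ) : ℝ) = ((k - (j + 1) : ℤ) : ℝ) + 1 := by push_cast; ring
    simp only [hcast]
    exact Gamma_div_Gamma_add_one_le hα0 hα1 hs

theorem nablaCaputo_const_mul_sub (α : ℝ) (a : ℤ) (c : ℝ) (f g : ℤ → ℝ) (k : ℤ) :
    nablaCaputo α a (fun j => c * f j - g j) k =
      c * nablaCaputo α a f k - nablaCaputo α a g k := by
  simp only [nablaCaputo]
  rw [Finset.mul_sum, ← Finset.sum_sub_distrib]
  exact Finset.sum_congr rfl fun j _ => by ring

theorem nablaC_pow_ineq_two (α : ℝ) (hα0 : 0 < α) (hα1 : α < 1) (a : ℤ)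
    (m n : ℕ) (hm : 0 < m) (hn : 0 < n) (hmn : n < 2 * m) (x : ℤ → ℝ) (k : ℤ) (hk : a ≤ k) :
    nablaCaputo α a (fun j => x j ^ (2 * m)) k ≤
      (2 * m : ℝ) / ((2 * m : ℝ) - (n : ℝ)) * x k ^ n * nablaCaputo α a (fun j => x j ^ (2 * m - n)) k := by
  rw [← sub_nonneg, ← nablaCaputo_const_mul_sub]
  refine nablaCaputo_nonneg_of_le hα0.le hα1 hk fun j => ?_
  have hd : (0 : ℝ) < 2 * m - n := by
    rw [sub_pos]
    exact_mod_cast hmn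
  have h := mul_pow_mul_pow_sub_le (2 * m) n (even_two_mul m) hmn (x k) (x j)
  push_cast at h
  have hk_pow : x k ^ n * x k ^ (2 * m - n) = x k ^ (2 * m) := by
    rw [← pow_add, Nat.add_sub_cancel' hmn.le]
  rw [mul_assoc, mul_assoc, hk_pow, ← sub_nonneg]
  have heq : 2 * m / (2 * m - n) * x k ^ (2 * m) - x k ^ (2 * m) -
      (2 * m / (2 * m - n) * (x k ^ n * x j ^ (2 * m - n)) - x j ^ (2 * m)) =
      (n * x k ^ (2 * m) + (2 * m - n) * x j ^ (2 * m) -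
        2 * m * (x k ^ n * x j ^ (2 * m - n))) / (2 * m - n : ℝ) := by
    field_simp
    ring
  rw [heq]
  exact div_nonneg (sub_nonneg.2 h) hd.le
end

section
/- Let α ∈ (0,1), let a be an integer, let m, n be positive integers with 2m ≥ n, and let x : ℤ → ℝ. Then for every integer k ≥ a, ᶜ∇ᵃ_k^α (x^{2m}) ≤ (2m/n) · x(k)^{2m−n} · ᶜ∇ᵃ_k^α (x^n), where x^p denotes the function j ↦ x(j)^p. -/
theorem sum_Icc_mul_sub_le {w ψ : ℤ → ℝ} {a k : ℤ} (hak : a ≤ k)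
    (hw : ∀ j ≤ k, 0 ≤ w j) (hmono : ∀ j < k, w j ≤ w (j + 1)) (hψ : ∀ j, 0 ≤ ψ j) :
    ∑ j ∈ Finset.Icc a k, w j * (ψ j - ψ (j - 1)) ≤ w k * ψ k := by
  suffices h : ∀ N, a ≤ N → N ≤ k →
      ∑ j ∈ Finset.Icc a N, w j * (ψ j - ψ (j - 1)) ≤ w N * ψ N from h k hak le_rfl
  intro N hN
  induction N, hN using Int.leInduction with
  | base =>
    intro h
    rw [Finset.Icc_self, Finset.sum_singleton]
    nlinarith [mul_nonneg (hw a h) (hψ (a - 1))]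
  | succ N hN ih =>
    intro h
    have hins : Finset.Icc a (N + 1) = insert (N + 1) (Finset.Icc a N) := by
      ext j
      simp only [Finset.mem_Icc, Finset.mem_insert]
      omega
    rw [hins, Finset.sum_insert (by simp), add_sub_cancel_right]
    nlinarith [ih (by omega), mul_le_mul_of_nonneg_right (hmono N (by omega)) (hψ N)]

theorem gamma_add_one_sub_div_nonneg {α : ℝ} (hα1 : α < 1) {d : ℝ} (hd : 0 ≤ d) :
    0 ≤ Real.Gamma (d + 1 - α) / (Real.Gamma (1 - α) * Real.Gamma (d + 1)) := by
  have h1 := Real.Gamma_pos_of_pos (show 0 < d + 1 - α by linarith)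
  have h2 := Real.Gamma_pos_of_pos (show 0 < 1 - α by linarith)
  have h3 := Real.Gamma_pos_of_pos (show 0 < d + 1 by linarith)
  positivity

theorem gamma_add_one_sub_div_antitone {α : ℝ} (hα0 : 0 < α) (hα1 : α < 1) {d : ℝ}
    (hd : 0 ≤ d) :
    Real.Gamma (d + 1 + 1 - α) / (Real.Gamma (1 - α) * Real.Gamma (d + 1 + 1)) ≤
      Real.Gamma (d + 1 - α) / (Real.Gamma (1 - α) * Real.Gamma (d + 1)) := by
  have h1 := Real.Gamma_pos_of_pos (show 0 < d + 1 - α by linarith)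
  have h2 := Real.Gamma_pos_of_pos (show 0 < 1 - α by linarith)
  have h3 := Real.Gamma_pos_of_pos (show 0 < d + 1 by linarith)
  have hd1 : 0 < d + 1 := by linarith
  rw [show d + 1 + 1 - α = (d + 1 - α) + 1 by ring,
    Real.Gamma_add_one (show d + 1 - α ≠ 0 by linarith), Real.Gamma_add_one hd1.ne',
    div_le_div_iff₀ (by positivity) (by positivity)]
  have h4 : 0 < Real.Gamma (d + 1 - α) * (Real.Gamma (1 - α) * Real.Gamma (d + 1)) := by
    positivity
  nlinarith [mul_pos hα0 h4]

theorem pow_mul_pow_le_young {p q : ℕ} (hpq : 0 < p + q) {u v : ℝ} (hu : 0 ≤ u) (hv : 0 ≤ v) :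
    (p + q : ℝ) * (u ^ p * v ^ q) ≤ p * u ^ (p + q) + q * v ^ (p + q) := by
  have hs : (0 : ℝ) < p + q := by exact_mod_cast hpq
  have hroot : ∀ (r : ℕ) {t : ℝ}, 0 ≤ t → (t ^ (p + q)) ^ ((r : ℝ) / (p + q)) = t ^ r := by
    intro r t ht
    rw [← Real.rpow_natCast t (p + q), ← Real.rpow_mul ht, Nat.cast_add,
      mul_div_cancel₀ _ hs.ne', Real.rpow_natCast]
  have h := Real.geom_mean_le_arith_mean2_weighted (w₁ := (p : ℝ) / (p + q))
    (w₂ := (q : ℝ) / (p + q)) (by positivity) (by positivity) (pow_nonneg hu (p + q))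
    (pow_nonneg hv (p + q)) (by rw [← add_div, div_self hs.ne'])
  rw [hroot p hu, hroot q hv] at h
  calc (p + q : ℝ) * (u ^ p * v ^ q)
      ≤ (p + q) * (p / (p + q) * u ^ (p + q) + q / (p + q) * v ^ (p + q)) := by gcongr
    _ = p * u ^ (p + q) + q * v ^ (p + q) := by field_simp

theorem mul_pow_mul_pow_le_even {m n : ℕ} (hm : 0 < m) (hmn : n ≤ 2 * m) (c y : ℝ) :
    (2 * m : ℝ) * (c ^ (2 * m - n) * y ^ n) ≤
      (2 * m - n : ℝ) * c ^ (2 * m) + n * y ^ (2 * m) := by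
  have hadd : 2 * m - n + n = 2 * m := Nat.sub_add_cancel hmn
  have h := pow_mul_pow_le_young (p := 2 * m - n) (q := n) (by omega) (abs_nonneg c)
    (abs_nonneg y)
  rw [hadd, (even_two_mul m).pow_abs, (even_two_mul m).pow_abs, Nat.cast_sub hmn,
    sub_add_cancel, ← abs_pow, ← abs_pow, ← abs_mul] at h
  push_cast at h
  refine le_trans ?_ h
  gcongr
  exact le_abs_self _

theorem nablaC_pow_ineq_three (α : ℝ) (hα0 : 0 < α) (hα1 : α < 1) (a : ℤ)
    (m n : ℕ) (hm : 0 < m) (hn : 0 < n) (hmn : n ≤ 2 * m) (x : ℤ → ℝ) (k : ℤ) (hk : a ≤ k) :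
    nablaCaputo α a (fun j => x j ^ (2 * m)) k ≤
      (2 * m : ℝ) / (n : ℝ) * x k ^ (2 * m - n) * nablaCaputo α a (fun j => x j ^ n) k := by
  have hn' : (0 : ℝ) < n := by exact_mod_cast hn
  set C : ℝ := (2 * m : ℝ) / n * x k ^ (2 * m - n) with hC
  let ψ : ℤ → ℝ := fun j => x j ^ (2 * m) - C * x j ^ n - (x k ^ (2 * m) - C * x k ^ n)
  have hCk : C * x k ^ n = (2 * m : ℝ) / n * x k ^ (2 * m) := by
    rw [hC, mul_assoc, ← pow_add, Nat.sub_add_cancel hmn]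
  have hψ : ∀ j, 0 ≤ ψ j := by
    intro j
    have h : ψ j = ((2 * m - n : ℝ) * x k ^ (2 * m) + n * x j ^ (2 * m) -
        (2 * m : ℝ) * (x k ^ (2 * m - n) * x j ^ n)) / n := by
      simp only [ψ]
      rw [hCk, hC]
      field_simp
      ring
    rw [h]
    exact div_nonneg (sub_nonneg.2 (mul_pow_mul_pow_le_even hm hmn _ _)) hn'.le
  have key := sum_Icc_mul_sub_le (ψ := ψ) (w := fun j => Real.Gamma (((k - j : ℤ) : ℝ) + 1 - α) /
      (Real.Gamma (1 - α) * Real.Gamma (((k - j : ℤ) : ℝ) + 1))) hk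
    (fun j hj => gamma_add_one_sub_div_nonneg hα1 (by exact_mod_cast sub_nonneg.2 hj))
    (fun j hj => by
      have h := gamma_add_one_sub_div_antitone hα0 hα1 (d := ((k - (j + 1) : ℤ) : ℝ))
        (by exact_mod_cast (by omega : 0 ≤ k - (j + 1)))
      have hcast : ((k - (j + 1) : ℤ) : ℝ) + 1 = ((k - j : ℤ) : ℝ) := by push_cast; ring
      simpa only [hcast] using h)
    hψ
  rw [show ψ k = 0 from sub_self _, mul_zero] at key
  rw [← sub_nonpos]
  refine le_of_eq_of_le ?_ key
  rw [nablaCaputo, nablaCaputo, Finset.mul_sum, ← Finset.sum_sub_distrib]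
  refine Finset.sum_congr rfl fun j _ => ?_
  simp only [ψ]
  ring
end

section
/- Let α ∈ (0,1), let a be an integer, let κ be a positive integer, let y : ℤ → ℝ^κ, and let P be a symmetric positive definite real κ×κ matrix. Then for every integer k ≥ a, ᶜ∇ᵃ_k^α (j ↦ y(j)ᵀ P y(j)) ≤ 2 · y(k)ᵀ P (ᶜ∇ᵃ_k^α y), where the fractional difference of the vector-valued function y is taken componentwise. -/
open Matrix

theorem Finset.sum_Icc_mul_sub_le (a n : ℤ) (han : a ≤ n) (c V : ℤ → ℝ)
    (hc : 0 ≤ c a) (hmono : ∀ j, a ≤ j → j < n → c j ≤ c (j + 1)) (hV : ∀ j, 0 ≤ V j) :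
    ∑ j ∈ Finset.Icc a n, c j * (V j - V (j - 1)) ≤ c n * V n := by
  induction n, han using Int.leInduction with
  | base =>
    rw [Finset.Icc_self, Finset.sum_singleton]
    nlinarith [mul_nonneg hc (hV (a - 1))]
  | succ n han ih =>
    have hsum := ih fun j haj hjn => hmono j haj (by lia)
    have hstep := mul_le_mul_of_nonneg_right (hmono n han (by lia)) (hV n)
    rw [← Finset.insert_Icc_right_eq_Icc_add_one (by lia), Finset.sum_insert (by simp),
      add_sub_cancel_right]
    linarith

/-- The kernel `Γ(m + 1 - α) / (Γ(1 - α) Γ(m + 1))` of the Caputo difference is antitone. -/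
theorem Real.Gamma_quotient_succ_le {α : ℝ} (hα0 : 0 < α) (hα1 : α < 1) {x : ℝ} (hx : 0 ≤ x) :
    Real.Gamma (x + 1 + 1 - α) / (Real.Gamma (1 - α) * Real.Gamma (x + 1 + 1)) ≤
      Real.Gamma (x + 1 - α) / (Real.Gamma (1 - α) * Real.Gamma (x + 1)) := by
  have h₁ : 0 < Real.Gamma (1 - α) := Real.Gamma_pos_of_pos (by linarith)
  have h₂ : 0 < Real.Gamma (x + 1) := Real.Gamma_pos_of_pos (by linarith)
  have h₃ : 0 < Real.Gamma (x + 1 - α) := Real.Gamma_pos_of_pos (by linarith)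
  rw [show x + 1 + 1 - α = x + 1 - α + 1 by ring, Real.Gamma_add_one (by linarith),
    Real.Gamma_add_one (by linarith), div_le_div_iff₀ (by positivity) (by positivity)]
  have h : 0 ≤ α * (Real.Gamma (x + 1 - α) * (Real.Gamma (1 - α) * Real.Gamma (x + 1))) := by
    positivity
  linarith

theorem Matrix.IsSymm.dotProduct_mulVec_comm {n : Type*} [Fintype n] {P : Matrix n n ℝ}
    (hP : P.IsSymm) (u v : n → ℝ) : u ⬝ᵥ P.mulVec v = v ⬝ᵥ P.mulVec u := by
  rw [dotProduct_mulVec, ← mulVec_transpose, hP.eq, dotProduct_comm]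

theorem nablaC_quadratic (α : ℝ) (hα0 : 0 < α) (hα1 : α < 1) (a : ℤ)
    (κ : ℕ) (hκ : 0 < κ) (y : ℤ → Fin κ → ℝ) (P : Matrix (Fin κ) (Fin κ) ℝ)
    (hPsymm : P.IsSymm) (hP : P.PosDef) (k : ℤ) (hk : a ≤ k) :
    nablaCaputo α a (fun j => y j ⬝ᵥ P.mulVec (y j)) k ≤
      2 * (y k ⬝ᵥ P.mulVec (fun i => nablaCaputo α a (fun j => y j i) k)) := by
  set c : ℤ → ℝ := fun j => Real.Gamma (((k - j : ℤ) : ℝ) + 1 - α) /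
    (Real.Gamma (1 - α) * Real.Gamma (((k - j : ℤ) : ℝ) + 1)) with hc
  set V : ℤ → ℝ := fun j => (y j - y k) ⬝ᵥ P.mulVec (y j - y k) with hV
  have hlin : y k ⬝ᵥ P.mulVec (fun i => nablaCaputo α a (fun j => y j i) k) =
      ∑ j ∈ Finset.Icc a k, c j * (y k ⬝ᵥ P.mulVec (y j - y (j - 1))) := by
    have hvec : (fun i => nablaCaputo α a (fun j => y j i) k) =
        ∑ j ∈ Finset.Icc a k, c j • (y j - y (j - 1)) := by
      ext i
      simp [nablaCaputo, hc]
    simp only [hvec, mulVec_sum, dotProduct_sum, mulVec_smul, dotProduct_smul, smul_eq_mul]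
  have hle : ∑ j ∈ Finset.Icc a k, c j * (V j - V (j - 1)) ≤ c k * V k := by
    refine Finset.sum_Icc_mul_sub_le a k hk c V ?_ (fun j _ hjk => ?_) fun j => ?_
    · have hak : (0 : ℝ) ≤ ((k - a : ℤ) : ℝ) := by exact_mod_cast sub_nonneg.2 hk
      exact div_nonneg (Real.Gamma_nonneg_of_nonneg (by linarith))
        (mul_nonneg (Real.Gamma_nonneg_of_nonneg (by linarith))
          (Real.Gamma_nonneg_of_nonneg (by linarith)))
    · have hx : (0 : ℝ) ≤ ((k - (j + 1) : ℤ) : ℝ) := by exact_mod_cast (by lia : 0 ≤ k - (j + 1))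
      have hcast : ((k - j : ℤ) : ℝ) = ((k - (j + 1) : ℤ) : ℝ) + 1 := by push_cast; ring
      simp only [hc, hcast]
      exact Real.Gamma_quotient_succ_le hα0 hα1 hx
    · exact hP.posSemidef.dotProduct_mulVec_nonneg (y j - y k)
  have hVk : V k = 0 := by simp [hV]
  rw [hVk, mul_zero] at hle
  rw [hlin, ← sub_nonpos, nablaCaputo, Finset.mul_sum, ← Finset.sum_sub_distrib]
  refine le_of_eq_of_le (Finset.sum_congr rfl fun j _ => ?_) hle
  simp only [hV, mulVec_sub, dotProduct_sub, sub_dotProduct,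
    hPsymm.dotProduct_mulVec_comm (y j) (y k), hPsymm.dotProduct_mulVec_comm (y (j - 1)) (y k)]
  ring
end

section
/- Let α ∈ (0,1), let a be an integer, let m be a positive integer, and let x : ℤ → ℝ. Then for every integer k ≥ a, ᶜ∇ᵃ_k^α (x^{2m}) ≤ (2m/(2m−1)) · x(k) · ᶜ∇ᵃ_k^α (x^{2m−1}), where x^p denotes the function j ↦ x(j)^p. -/
theorem succ_mul_mul_pow_le_of_nonneg {X y : ℝ} (hX : 0 ≤ X) (hy : 0 ≤ y) (n : ℕ) :
    (n + 1 : ℝ) * X * y ^ n ≤ X ^ (n + 1) + n * y ^ (n + 1) := by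
  induction n with
  | zero => simp
  | succ n ih =>
    have h₁ := mul_le_mul_of_nonneg_left ih hX
    have h₂ : 0 ≤ y ^ n * (n + 1 : ℝ) * (X - y) ^ 2 := by positivity
    push_cast
    ring_nf at h₁ h₂ ⊢
    linarith

theorem succ_mul_mul_pow_le_of_even (X y : ℝ) {n : ℕ} (hn : Even (n + 1)) :
    (n + 1 : ℝ) * X * y ^ n ≤ X ^ (n + 1) + n * y ^ (n + 1) := by
  rw [← hn.pow_abs X, ← hn.pow_abs y]
  refine le_trans ?_ (succ_mul_mul_pow_le_of_nonneg (abs_nonneg X) (abs_nonneg y) n)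
  rw [mul_assoc, mul_assoc, ← abs_pow, ← abs_mul]
  gcongr
  exact le_abs_self _

/-- Summation by parts for an antitone weight and a nonpositive sequence. -/
theorem Antitone.le_sum_mul_sub {w g : ℕ → ℝ} (hw : Antitone w) (hg : ∀ i, g i ≤ 0) (n : ℕ) :
    w 0 * g 0 - w n * g n ≤ ∑ i ∈ Finset.range n, w i * (g i - g (i + 1)) := by
  induction n with
  | zero => simp
  | succ n ih =>
    rw [Finset.sum_range_succ]
    have := mul_le_mul_of_nonpos_right (hw n.le_succ) (hg (n + 1))
    linarith

noncomputable def nablaCaputoWeight (α : ℝ) (i : ℕ) : ℝ :=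
  Real.Gamma ((i : ℝ) + 1 - α) / (Real.Gamma (1 - α) * Real.Gamma ((i : ℝ) + 1))

theorem nablaCaputoWeight_nonneg {α : ℝ} (hα1 : α < 1) (i : ℕ) : 0 ≤ nablaCaputoWeight α i := by
  have hi : (0 : ℝ) ≤ i := i.cast_nonneg
  have h₁ : 0 < Real.Gamma ((i : ℝ) + 1 - α) := Real.Gamma_pos_of_pos (by linarith)
  have h₂ : 0 < Real.Gamma (1 - α) := Real.Gamma_pos_of_pos (by linarith)
  have h₃ : 0 < Real.Gamma ((i : ℝ) + 1) := Real.Gamma_pos_of_pos (by linarith)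
  unfold nablaCaputoWeight
  positivity

theorem nablaCaputoWeight_succ {α : ℝ} (hα1 : α < 1) (i : ℕ) :
    nablaCaputoWeight α (i + 1) = ((i : ℝ) + 1 - α) / (i + 1) * nablaCaputoWeight α i := by
  have hi : (0 : ℝ) ≤ i := i.cast_nonneg
  have h₁ : (i : ℝ) + 1 - α ≠ 0 := by linarith
  have h₂ : (i : ℝ) + 1 ≠ 0 := by positivity
  unfold nablaCaputoWeight
  push_cast
  rw [show (i : ℝ) + 1 + 1 - α = ((i : ℝ) + 1 - α) + 1 by ring, Real.Gamma_add_one h₁,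
    Real.Gamma_add_one h₂, div_mul_div_comm]
  congr 1
  ring

theorem nablaCaputoWeight_antitone {α : ℝ} (hα0 : 0 ≤ α) (hα1 : α < 1) :
    Antitone (nablaCaputoWeight α) := by
  refine antitone_nat_of_succ_le fun i => ?_
  rw [nablaCaputoWeight_succ hα1]
  refine mul_le_of_le_one_left (nablaCaputoWeight_nonneg hα1 i) ?_
  rw [div_le_one (by positivity)]
  linarith

theorem nablaCaputo_eq_sum_range (α : ℝ) (a : ℤ) (f : ℤ → ℝ) (k : ℤ) :
    nablaCaputo α a f k = ∑ i ∈ Finset.range (k + 1 - a).toNat,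
      nablaCaputoWeight α i * (f (k - i) - f (k - (i + 1 : ℕ))) := by
  unfold nablaCaputo nablaCaputoWeight
  symm
  refine Finset.sum_bij' (fun i _ => k - (i : ℤ)) (fun j _ => (k - j).toNat) ?_ ?_ ?_ ?_ ?_
  · intro i hi
    simp only [Finset.mem_range, Finset.mem_Icc] at *
    omega
  · intro j hj
    simp only [Finset.mem_range, Finset.mem_Icc] at *
    omega
  · intro i _
    simp
  · intro j hj
    simp only [Finset.mem_Icc] at *
    omega
  · intro i _
    simp [sub_sub]

/-- The nabla Caputo difference is nonnegative at a global maximum. -/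
theorem nablaCaputo_nonneg_of_forall_le {α : ℝ} (hα0 : 0 ≤ α) (hα1 : α < 1) (a : ℤ)
    {f : ℤ → ℝ} {k : ℤ} (hf : ∀ j, f j ≤ f k) : 0 ≤ nablaCaputo α a f k := by
  rw [nablaCaputo_eq_sum_range]
  have h := (nablaCaputoWeight_antitone hα0 hα1).le_sum_mul_sub
    (g := fun i => f (k - i) - f k) (fun i => sub_nonpos.2 (hf _)) (k + 1 - a).toNat
  have h' := mul_nonpos_of_nonneg_of_nonpos (nablaCaputoWeight_nonneg hα1 (k + 1 - a).toNat)
    (sub_nonpos.2 (hf (k - ((k + 1 - a).toNat : ℕ))))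
  simp only [sub_sub_sub_cancel_right, Nat.cast_zero, sub_zero, sub_self, mul_zero] at h
  linarith

theorem nablaC_cor_one (α : ℝ) (hα0 : 0 < α) (hα1 : α < 1) (a : ℤ)
    (m : ℕ) (hm : 0 < m) (x : ℤ → ℝ) (k : ℤ) (hk : a ≤ k) :
    nablaCaputo α a (fun j => x j ^ (2 * m)) k ≤
      (2 * m : ℝ) / ((2 * m : ℝ) - 1) * x k * nablaCaputo α a (fun j => x j ^ (2 * m - 1)) k := by
  obtain ⟨n, hn⟩ : ∃ n, 2 * m = n + 1 := ⟨2 * m - 1, by omega⟩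
  have hn' : (2 * m : ℝ) = n + 1 := by exact_mod_cast hn
  have hpos : (0 : ℝ) < n := by
    have : 0 < n := by omega
    exact_mod_cast this
  rw [hn', hn, Nat.add_sub_cancel, add_sub_cancel_right, ← sub_nonneg,
    ← nablaCaputo_const_mul_sub]
  refine nablaCaputo_nonneg_of_forall_le hα0.le hα1 a fun j => ?_
  have h := succ_mul_mul_pow_le_of_even (x k) (x j) (hn ▸ even_two_mul m)
  have h_at_j : ((n : ℝ) + 1) / n * x k * x j ^ n - x j ^ (n + 1) =
      ((n + 1) * x k * x j ^ n - n * x j ^ (n + 1)) / n := by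
    field_simp
  have h_at_k : ((n : ℝ) + 1) / n * x k * x k ^ n - x k ^ (n + 1) = x k ^ (n + 1) / n := by
    field_simp
    ring
  rw [h_at_j, h_at_k]
  gcongr
  linarith
end

section
/- Let α ∈ (0,1), let a be an integer, and let x : ℤ → ℝ. Then for every integer k ≥ a, ᶜ∇ᵃ_k^α (x²) ≤ 2 · x(k) · ᶜ∇ᵃ_k^α x, where x² denotes the function j ↦ x(j)². -/
/-- The coefficient `Γ(t + 1 - α) / (Γ(1 - α) Γ(t + 1))` is nonnegative. -/
theorem Real.Gamma_ratio_nonneg {α t : ℝ} (hα : α < 1) (ht : 0 ≤ t) :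
    0 ≤ Real.Gamma (t + 1 - α) / (Real.Gamma (1 - α) * Real.Gamma (t + 1)) := by
  have h₁ := Real.Gamma_pos_of_pos (show 0 < t + 1 - α by linarith)
  have h₂ := Real.Gamma_pos_of_pos (show 0 < 1 - α by linarith)
  have h₃ := Real.Gamma_pos_of_pos (show 0 < t + 1 by linarith)
  positivity

/-- The coefficient `Γ(t + 1 - α) / (Γ(1 - α) Γ(t + 1))` does not increase under `t ↦ t + 1`. -/
theorem Real.Gamma_ratio_add_one_le {α t : ℝ} (hα₀ : 0 ≤ α) (hα₁ : α < 1) (ht : 0 ≤ t) :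
    Real.Gamma (t + 1 + 1 - α) / (Real.Gamma (1 - α) * Real.Gamma (t + 1 + 1)) ≤
      Real.Gamma (t + 1 - α) / (Real.Gamma (1 - α) * Real.Gamma (t + 1)) := by
  have h₁ := Real.Gamma_pos_of_pos (show 0 < t + 1 - α by linarith)
  have h₂ := Real.Gamma_pos_of_pos (show 0 < 1 - α by linarith)
  have h₃ := Real.Gamma_pos_of_pos (show 0 < t + 1 by linarith)
  rw [show t + 1 + 1 - α = (t + 1 - α) + 1 by ring,
    Real.Gamma_add_one (show t + 1 - α ≠ 0 by linarith),
    Real.Gamma_add_one (show t + 1 ≠ 0 by linarith), div_le_div_iff₀ (by positivity) (by positivity)]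
  have := mul_nonneg hα₀ (mul_pos h₁ (mul_pos h₂ h₃)).le
  linarith

/-- Summation by parts against a nonincreasing kernel, for a nonnegative function vanishing
at the right endpoint. -/
theorem sum_Icc_kernel_mul_sub_le {v y : ℤ → ℝ} {a k : ℤ} (hak : a ≤ k)
    (hv : ∀ n, 0 ≤ n → v (n + 1) ≤ v n) (hy : ∀ j, 0 ≤ y j) (hyk : y k = 0) :
    ∑ j ∈ Finset.Icc a k, v (k - j) * (y j - y (j - 1)) ≤ -(v (k - a) * y (a - 1)) := by
  induction a, hak using Int.leInductionDown with
  | base => simp [hyk]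
  | pred a hak ih =>
    have hs : Finset.Icc (a - 1) k = insert (a - 1) (Finset.Icc a k) := by
      ext j
      simp only [Finset.mem_Icc, Finset.mem_insert]
      omega
    rw [hs, Finset.sum_insert (by simp)]
    have h := mul_le_mul_of_nonneg_right (hv (k - a) (by omega)) (hy (a - 1))
    rw [show k - a + 1 = k - (a - 1) by ring] at h
    linarith

theorem nablaC_cor_three (α : ℝ) (hα0 : 0 < α) (hα1 : α < 1) (a : ℤ)
     (x : ℤ → ℝ) (k : ℤ) (hk : a ≤ k) :
    nablaCaputo α a (fun j => x j ^ 2) k ≤ 2 * x k * nablaCaputo α a x k := by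
  have hsum := sum_Icc_kernel_mul_sub_le (y := fun j => (x k - x j) ^ 2)
    (v := fun n : ℤ => Real.Gamma ((n : ℝ) + 1 - α) /
      (Real.Gamma (1 - α) * Real.Gamma ((n : ℝ) + 1))) hk
    (fun n hn => by
      have := Real.Gamma_ratio_add_one_le hα0.le hα1 (Int.cast_nonneg (R := ℝ) hn)
      push_cast
      exact this)
    (fun j => sq_nonneg _) (by simp)
  have hbdry := mul_nonneg
    (Real.Gamma_ratio_nonneg hα1 (Int.cast_nonneg (R := ℝ) (sub_nonneg.2 hk)))
    (sq_nonneg (x k - x (a - 1)))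
  rw [← sub_nonpos]
  refine le_trans (le_of_eq ?_) (hsum.trans (neg_nonpos.2 hbdry))
  unfold nablaCaputo
  rw [Finset.mul_sum, ← Finset.sum_sub_distrib]
  exact Finset.sum_congr rfl fun j _ => by ring
end

section
/- Let α ∈ (0,1), let a be an integer, let m be a positive integer, and let x : ℤ → ℝ. Then for every integer k ≥ a, ᴿ∇ᵃ_k^α (x^{2m}) ≤ 2·x(k)^m · ᴿ∇ᵃ_k^α (x^m), where x^p denotes the function j ↦ x(j)^p. -/
noncomputable def nablaRL (α : ℝ) (a : ℤ) (f : ℤ → ℝ) (k : ℤ) : ℝ :=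
  (∑ j ∈ Finset.Icc a k,
    Real.Gamma (((k - j : ℤ) : ℝ) + 1 - α) /
      (Real.Gamma (1 - α) * Real.Gamma (((k - j : ℤ) : ℝ) + 1)) * f j) -
  ∑ j ∈ Finset.Icc a (k - 1),
    Real.Gamma (((k - j : ℤ) : ℝ) - α) /
      (Real.Gamma (1 - α) * Real.Gamma (((k - j : ℤ) : ℝ))) * f j

/-- The kernel of the nabla fractional sum of order `1 - α`. -/
noncomputable def nablaKernel (α t : ℝ) : ℝ :=
  Real.Gamma (t + 1 - α) / (Real.Gamma (1 - α) * Real.Gamma (t + 1))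

theorem nablaKernel_pos {α t : ℝ} (hα : α < 1) (ht : 0 ≤ t) : 0 < nablaKernel α t :=
  div_pos (Real.Gamma_pos_of_pos (by linarith))
    (mul_pos (Real.Gamma_pos_of_pos (by linarith)) (Real.Gamma_pos_of_pos (by linarith)))

theorem nablaKernel_add_one {α t : ℝ} (hα : α < 1) (ht : 0 ≤ t) :
    nablaKernel α (t + 1) = (t + 1 - α) / (t + 1) * nablaKernel α t := by
  unfold nablaKernel
  rw [show t + 1 + 1 - α = (t + 1 - α) + 1 by ring,
    Real.Gamma_add_one (show t + 1 - α ≠ 0 by linarith),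
    Real.Gamma_add_one (show t + 1 ≠ 0 by linarith), div_mul_div_comm]
  congr 1
  ring

theorem nablaKernel_add_one_le {α t : ℝ} (hα0 : 0 ≤ α) (hα1 : α < 1) (ht : 0 ≤ t) :
    nablaKernel α (t + 1) ≤ nablaKernel α t := by
  rw [nablaKernel_add_one hα1 ht]
  refine mul_le_of_le_one_left (nablaKernel_pos hα1 ht).le ?_
  rw [div_le_one (by linarith)]
  linarith

theorem nablaRL_eq_sum_nablaKernel (α : ℝ) (a : ℤ) (f : ℤ → ℝ) (k : ℤ) :
    nablaRL α a f k = ∑ j ∈ Finset.Icc a k, nablaKernel α ((k - j : ℤ) : ℝ) * f j -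
      ∑ j ∈ Finset.Icc a (k - 1), nablaKernel α ((k - 1 - j : ℤ) : ℝ) * f j := by
  unfold nablaRL nablaKernel
  congr 1
  refine Finset.sum_congr rfl fun j _ => ?_
  have h : ((k - 1 - j : ℤ) : ℝ) + 1 = ((k - j : ℤ) : ℝ) := by push_cast; ring
  rw [h]

/-- The fractional difference of a constant function. -/
theorem nablaRL_const (α : ℝ) {a k : ℤ} (hk : a ≤ k) (c : ℝ) :
    nablaRL α a (fun _ => c) k = nablaKernel α ((k - a : ℤ) : ℝ) * c := by
  have shift : ∑ j ∈ Finset.Icc a (k - 1), nablaKernel α ((k - 1 - j : ℤ) : ℝ) * c =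
      ∑ j ∈ Finset.Ioc a k, nablaKernel α ((k - j : ℤ) : ℝ) * c := by
    refine Finset.sum_bij' (fun j _ => j + 1) (fun j _ => j - 1) ?_ ?_ ?_ ?_ ?_
    · intro j hj
      rw [Finset.mem_Icc] at hj
      rw [Finset.mem_Ioc]
      omega
    · intro j hj
      rw [Finset.mem_Ioc] at hj
      rw [Finset.mem_Icc]
      omega
    · intro j _
      ring
    · intro j _
      ring
    · intro j _
      rw [show k - 1 - j = k - (j + 1) by ring]
  rw [nablaRL_eq_sum_nablaKernel, shift, ← Finset.add_sum_Ioc_eq_sum_Icc hk]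
  ring

/-- The fractional difference is nonpositive at a zero of a nonnegative function. -/
theorem nablaRL_nonpos_of_nonneg {α : ℝ} (hα0 : 0 ≤ α) (hα1 : α < 1) (a : ℤ) {f : ℤ → ℝ}
    (hf : ∀ j, 0 ≤ f j) {k : ℤ} (hfk : f k = 0) : nablaRL α a f k ≤ 0 := by
  have drop : ∑ j ∈ Finset.Icc a k, nablaKernel α ((k - j : ℤ) : ℝ) * f j =
      ∑ j ∈ Finset.Icc a (k - 1), nablaKernel α ((k - j : ℤ) : ℝ) * f j := by
    symm
    refine Finset.sum_subset (Finset.Icc_subset_Icc_right (by omega)) fun j hj hj' => ?_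
    rw [Finset.mem_Icc] at hj hj'
    rw [show j = k by omega, hfk, mul_zero]
  rw [nablaRL_eq_sum_nablaKernel, drop, sub_nonpos]
  refine Finset.sum_le_sum fun j hj => mul_le_mul_of_nonneg_right ?_ (hf j)
  rw [Finset.mem_Icc] at hj
  have ht : (0 : ℝ) ≤ ((k - 1 - j : ℤ) : ℝ) := by
    exact_mod_cast (show (0 : ℤ) ≤ k - 1 - j by omega)
  rw [show ((k - j : ℤ) : ℝ) = ((k - 1 - j : ℤ) : ℝ) + 1 by push_cast; ring]
  exact nablaKernel_add_one_le hα0 hα1 ht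

theorem nablaRL_add (α : ℝ) (a : ℤ) (f g : ℤ → ℝ) (k : ℤ) :
    nablaRL α a (fun j => f j + g j) k = nablaRL α a f k + nablaRL α a g k := by
  simp only [nablaRL, mul_add, Finset.sum_add_distrib]
  ring

theorem nablaRL_const_mul (α : ℝ) (a : ℤ) (c : ℝ) (f : ℤ → ℝ) (k : ℤ) :
    nablaRL α a (fun j => c * f j) k = c * nablaRL α a f k := by
  simp only [nablaRL, mul_left_comm _ c, ← Finset.mul_sum]
  ring

theorem nablaRL_sq_le {α : ℝ} (hα0 : 0 ≤ α) (hα1 : α < 1) {a k : ℤ} (hk : a ≤ k)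
    (y : ℤ → ℝ) : nablaRL α a (fun j => y j ^ 2) k ≤ 2 * y k * nablaRL α a y k := by
  have hsq := nablaRL_nonpos_of_nonneg hα0 hα1 a (f := fun j => (y j - y k) ^ 2)
    (fun j => sq_nonneg _) (k := k) (by simp)
  have expand : (fun j => (y j - y k) ^ 2) =
      fun j => (y j ^ 2 + (-(2 * y k)) * y j) + y k ^ 2 := by
    funext j
    ring
  rw [expand, nablaRL_add, nablaRL_add, nablaRL_const_mul, nablaRL_const α hk] at hsq
  have ht : (0 : ℝ) ≤ ((k - a : ℤ) : ℝ) := by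
    exact_mod_cast (show (0 : ℤ) ≤ k - a by omega)
  have hconst := mul_nonneg (nablaKernel_pos hα1 ht).le (sq_nonneg (y k))
  linarith

theorem nablaR_pow_two_mul (α : ℝ) (hα0 : 0 < α) (hα1 : α < 1) (a : ℤ)
    (m : ℕ) (hm : 0 < m) (x : ℤ → ℝ) (k : ℤ) (hk : a ≤ k) :
    nablaRL α a (fun j => x j ^ (2 * m)) k ≤ 2 * x k ^ m * nablaRL α a (fun j => x j ^ m) k := by
  simpa only [← pow_mul, mul_comm m 2] using nablaRL_sq_le hα0.le hα1 hk fun j => x j ^ m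
end

section
/- Let α ∈ (0,1), let a be an integer, let m, n be positive integers with 2m > n, and let x : ℤ → ℝ. Then for every integer k ≥ a, ᴿ∇ᵃ_k^α (x^{2m}) ≤ (2m/(2m−n)) · x(k)^n · ᴿ∇ᵃ_k^α (x^{2m−n}), where x^p denotes the function j ↦ x(j)^p. -/
lemma nablaKernel_zero {α : ℝ} (hα1 : α < 1) : nablaKernel α 0 = 1 := by
  have : Real.Gamma (1 - α) ≠ 0 := (Real.Gamma_pos_of_pos (by linarith)).ne'
  simp [nablaKernel, this]

lemma nablaKernel_nonneg {α t : ℝ} (hα1 : α < 1) (ht : 0 ≤ t) : 0 ≤ nablaKernel α t := by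
  have h1 := Real.Gamma_pos_of_pos (show 0 < t + 1 - α by linarith)
  have h2 := Real.Gamma_pos_of_pos (show 0 < 1 - α by linarith)
  have h3 := Real.Gamma_pos_of_pos (show 0 < t + 1 by linarith)
  unfold nablaKernel
  positivity

lemma nablaKernel_le_sub_one {α t : ℝ} (hα0 : 0 < α) (hα1 : α < 1) (ht : 1 ≤ t) :
    nablaKernel α t ≤ nablaKernel α (t - 1) := by
  have hΓ : Real.Gamma (t + 1 - α) = (t - α) * Real.Gamma (t - α) := by
    rw [← Real.Gamma_add_one (by linarith)]
    ring_nf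
  have h1 := Real.Gamma_pos_of_pos (show 0 < t - α by linarith)
  have h2 := Real.Gamma_pos_of_pos (show 0 < 1 - α by linarith)
  have h3 := Real.Gamma_pos_of_pos (show 0 < t by linarith)
  unfold nablaKernel
  rw [hΓ, Real.Gamma_add_one (by linarith), sub_add_cancel,
    div_le_div_iff₀ (by positivity) (by positivity)]
  have := mul_pos (mul_pos h1 h2) h3
  nlinarith [mul_pos hα0 this]

lemma nablaRL_eq {α : ℝ} (hα1 : α < 1) (a : ℤ) (f : ℤ → ℝ) {k : ℤ} (hk : a ≤ k) :
    nablaRL α a f k = f k - ∑ j ∈ Finset.Icc a (k - 1),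
      (nablaKernel α (((k - j : ℤ) : ℝ) - 1) - nablaKernel α ((k - j : ℤ) : ℝ)) * f j := by
  have hIcc : Finset.Icc a k = insert k (Finset.Icc a (k - 1)) := by
    ext j
    simp only [Finset.mem_Icc, Finset.mem_insert]
    lia
  have hsum : ∑ j ∈ Finset.Icc a k, nablaKernel α ((k - j : ℤ) : ℝ) * f j =
      f k + ∑ j ∈ Finset.Icc a (k - 1), nablaKernel α ((k - j : ℤ) : ℝ) * f j := by
    rw [hIcc, Finset.sum_insert (by simp), sub_self, Int.cast_zero, nablaKernel_zero hα1, one_mul]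
  simp only [sub_mul, Finset.sum_sub_distrib]
  simp only [nablaKernel, sub_add_cancel] at hsum ⊢
  rw [nablaRL, hsum]
  ring

lemma sum_nablaKernel_sub {α : ℝ} (hα1 : α < 1) {a k : ℤ} (hk : a ≤ k) :
    ∑ j ∈ Finset.Icc a (k - 1),
      (nablaKernel α (((k - j : ℤ) : ℝ) - 1) - nablaKernel α ((k - j : ℤ) : ℝ)) =
      1 - nablaKernel α ((k - a : ℤ) : ℝ) := by
  induction a, hk using Int.leInductionDown with
  | base => simp [nablaKernel_zero hα1]
  | pred a ha ih =>
    have hIcc : Finset.Icc (a - 1) (k - 1) = insert (a - 1) (Finset.Icc a (k - 1)) := by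
      ext j
      simp only [Finset.mem_Icc, Finset.mem_insert]
      lia
    have hcast : ((k - (a - 1) : ℤ) : ℝ) - 1 = ((k - a : ℤ) : ℝ) := by push_cast; ring
    rw [hIcc, Finset.sum_insert (by simp), ih, hcast]
    ring

/-- The fractional difference is nonnegative at a nonnegative maximum. -/
lemma nablaRL_nonneg_of_le {α : ℝ} (hα0 : 0 < α) (hα1 : α < 1) {a k : ℤ} (hk : a ≤ k)
    {f : ℤ → ℝ} (hf : ∀ j, f j ≤ f k) (hfk : 0 ≤ f k) : 0 ≤ nablaRL α a f k := by
  rw [nablaRL_eq hα1 a f hk]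
  have hle : ∑ j ∈ Finset.Icc a (k - 1),
      (nablaKernel α (((k - j : ℤ) : ℝ) - 1) - nablaKernel α ((k - j : ℤ) : ℝ)) * f j ≤
      (1 - nablaKernel α ((k - a : ℤ) : ℝ)) * f k := by
    rw [← sum_nablaKernel_sub hα1 hk, Finset.sum_mul]
    refine Finset.sum_le_sum fun j hj => mul_le_mul_of_nonneg_left (hf j) ?_
    rw [Finset.mem_Icc] at hj
    refine sub_nonneg.2 (nablaKernel_le_sub_one hα0 hα1 ?_)
    exact_mod_cast (by lia : 1 ≤ k - j)
  have hker : 0 ≤ nablaKernel α ((k - a : ℤ) : ℝ) :=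
    nablaKernel_nonneg hα1 (by exact_mod_cast (by lia : 0 ≤ k - a))
  nlinarith [mul_nonneg hker hfk]

lemma nablaRL_const_mul_sub (α : ℝ) (a : ℤ) (c : ℝ) (f g : ℤ → ℝ) (k : ℤ) :
    nablaRL α a (fun j => c * f j - g j) k = c * nablaRL α a f k - nablaRL α a g k := by
  simp only [nablaRL, mul_sub, Finset.sum_sub_distrib, Finset.mul_sum, mul_left_comm _ c]
  ring

/-- Young's inequality with natural exponents, in the form without denominators. -/
lemma add_mul_pow_mul_pow_le {n q : ℕ} (hp : 0 < n + q) {u v : ℝ} (hu : 0 ≤ u) (hv : 0 ≤ v) :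
    ((n : ℝ) + q) * (u ^ n * v ^ q) ≤ n * u ^ (n + q) + q * v ^ (n + q) := by
  have hp' : (0 : ℝ) < n + q := by exact_mod_cast hp
  have hroot : ∀ (w : ℝ) (r : ℕ), 0 ≤ w → (w ^ (n + q)) ^ ((r : ℝ) / (n + q)) = w ^ r := by
    intro w r hw
    rw [← Real.rpow_natCast, ← Real.rpow_mul hw, Nat.cast_add, mul_div_cancel₀ _ hp'.ne',
      Real.rpow_natCast]
  have h := Real.geom_mean_le_arith_mean2_weighted (w₁ := (n : ℝ) / (n + q))
    (w₂ := (q : ℝ) / (n + q)) (by positivity) (by positivity) (pow_nonneg hu (n + q))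
    (pow_nonneg hv (n + q)) (by field_simp)
  rw [hroot u n hu, hroot v q hv] at h
  calc ((n : ℝ) + q) * (u ^ n * v ^ q)
      ≤ (n + q) * (n / (n + q) * u ^ (n + q) + q / (n + q) * v ^ (n + q)) := by gcongr
    _ = n * u ^ (n + q) + q * v ^ (n + q) := by field_simp

theorem nablaR_pow_ineq_two (α : ℝ) (hα0 : 0 < α) (hα1 : α < 1) (a : ℤ)
    (m n : ℕ) (hm : 0 < m) (hn : 0 < n) (hmn : n < 2 * m) (x : ℤ → ℝ) (k : ℤ) (hk : a ≤ k) :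
    nablaRL α a (fun j => x j ^ (2 * m)) k ≤
      (2 * m : ℝ) / ((2 * m : ℝ) - (n : ℝ)) * x k ^ n * nablaRL α a (fun j => x j ^ (2 * m - n)) k := by
  obtain ⟨q, hq⟩ := Nat.exists_eq_add_of_lt hmn
  obtain ⟨q, rfl⟩ : ∃ r, r = q + 1 := ⟨_, rfl⟩
  have hsub : 2 * m - n = q + 1 := by lia
  have hcast : (2 * m : ℝ) = n + ((q + 1 : ℕ) : ℝ) := by exact_mod_cast hq
  have hq0 : (0 : ℝ) < ((q + 1 : ℕ) : ℝ) := by positivity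
  rw [← sub_nonneg, ← nablaRL_const_mul_sub, hsub, hcast, add_sub_cancel_left]
  have heven : Even (2 * m) := even_two_mul m
  have hfk : (n + ((q + 1 : ℕ) : ℝ)) / ((q + 1 : ℕ) : ℝ) * x k ^ n * x k ^ (q + 1) -
      x k ^ (2 * m) = n / ((q + 1 : ℕ) : ℝ) * x k ^ (2 * m) := by
    rw [show 2 * m = n + (q + 1) from hq, pow_add]
    field_simp
    ring
  refine nablaRL_nonneg_of_le hα0 hα1 hk (fun j => ?_) ?_
  · have hy := add_mul_pow_mul_pow_le (n := n) (q := q + 1) (by lia) (abs_nonneg (x k))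
      (abs_nonneg (x j))
    rw [show n + (q + 1) = 2 * m from hq.symm, heven.pow_abs, heven.pow_abs, ← abs_pow,
      ← abs_pow, ← abs_mul] at hy
    have hle : (n + ((q + 1 : ℕ) : ℝ)) * (x k ^ n * x j ^ (q + 1)) ≤
        n * x k ^ (2 * m) + ((q + 1 : ℕ) : ℝ) * x j ^ (2 * m) :=
      (mul_le_mul_of_nonneg_left (le_abs_self _) (by positivity)).trans hy
    rw [hfk, sub_le_iff_le_add, mul_assoc, div_mul_eq_mul_div, div_le_iff₀ hq0]
    refine hle.trans_eq ?_
    field_simp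
  · rw [hfk]
    exact mul_nonneg (by positivity) (heven.pow_nonneg _)
end

section
/- Let α ∈ (0,1), let a be an integer, let m be a positive integer, and let x : ℤ → ℝ. Then for every integer k ≥ a, ᴿ∇ᵃ_k^α (x^{2^m}) ≤ 2^m · x(k)^{2^m − 1} · ᴿ∇ᵃ_k^α x, where x^p denotes the function j ↦ x(j)^p. -/
/-- The kernel `Γ(t + 1 - α) / (Γ(1 - α) Γ(t + 1))` of the fractional sum of order `1 - α`. -/
noncomputable def fracKernel (α t : ℝ) : ℝ :=
  Real.Gamma (t + 1 - α) / (Real.Gamma (1 - α) * Real.Gamma (t + 1))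

theorem fracKernel_zero {α : ℝ} (hα1 : α < 1) : fracKernel α 0 = 1 := by
  have h : Real.Gamma (1 - α) ≠ 0 := (Real.Gamma_pos_of_pos (by linarith)).ne'
  simp [fracKernel, h]

theorem fracKernel_nonneg {α t : ℝ} (hα1 : α < 1) (ht : 0 ≤ t) : 0 ≤ fracKernel α t := by
  have h₁ := Real.Gamma_pos_of_pos (show 0 < t + 1 - α by linarith)
  have h₂ := Real.Gamma_pos_of_pos (show 0 < 1 - α by linarith)
  have h₃ := Real.Gamma_pos_of_pos (show 0 < t + 1 by linarith)
  unfold fracKernel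
  positivity

theorem fracKernel_add_one {α t : ℝ} (hα1 : α < 1) (ht : 0 ≤ t) :
    fracKernel α (t + 1) = (t + 1 - α) / (t + 1) * fracKernel α t := by
  have h₁ : Real.Gamma (t + 1 + 1 - α) = (t + 1 - α) * Real.Gamma (t + 1 - α) := by
    rw [← Real.Gamma_add_one (by linarith)]
    ring_nf
  have h₂ : Real.Gamma (t + 1 + 1) = (t + 1) * Real.Gamma (t + 1) :=
    Real.Gamma_add_one (by linarith)
  rw [fracKernel, fracKernel, h₁, h₂, div_mul_div_comm]
  ring_nf

theorem fracKernel_add_one_le {α t : ℝ} (hα0 : 0 < α) (hα1 : α < 1) (ht : 0 ≤ t) :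
    fracKernel α (t + 1) ≤ fracKernel α t := by
  rw [fracKernel_add_one hα1 ht]
  refine mul_le_of_le_one_left (fracKernel_nonneg hα1 ht) ?_
  rw [div_le_one (by linarith)]
  linarith

theorem nablaRL_eq_fracKernel (α : ℝ) (a : ℤ) (f : ℤ → ℝ) (k : ℤ) :
    nablaRL α a f k =
      (∑ j ∈ Finset.Icc a k, fracKernel α ((k - j : ℤ) : ℝ) * f j) -
        ∑ j ∈ Finset.Icc a (k - 1), fracKernel α ((k - 1 - j : ℤ) : ℝ) * f j := by
  unfold nablaRL fracKernel
  congr 1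
  refine Finset.sum_congr rfl fun j _ => ?_
  have h : ((k - 1 - j : ℤ) : ℝ) + 1 = ((k - j : ℤ) : ℝ) := by
    push_cast
    ring
  rw [h]

theorem nablaRL_eq_sub_sum {α : ℝ} (hα1 : α < 1) {a k : ℤ} (hk : a ≤ k) (f : ℤ → ℝ) :
    nablaRL α a f k = f k - ∑ j ∈ Finset.Icc a (k - 1),
      (fracKernel α ((k - 1 - j : ℤ) : ℝ) - fracKernel α ((k - j : ℤ) : ℝ)) * f j := by
  have h : Finset.Icc a k = insert k (Finset.Icc a (k - 1)) := by
    ext j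
    simp only [Finset.mem_insert, Finset.mem_Icc]
    omega
  rw [nablaRL_eq_fracKernel, h, Finset.sum_insert (by simp)]
  simp only [sub_self, Int.cast_zero, fracKernel_zero hα1, one_mul, sub_mul,
    Finset.sum_sub_distrib]
  ring

theorem nablaRL_one_nonneg {α : ℝ} (hα1 : α < 1) (a k : ℤ) :
    0 ≤ nablaRL α a (fun _ => 1) k := by
  have h : ∑ j ∈ Finset.Icc a (k - 1), fracKernel α ((k - 1 - j : ℤ) : ℝ) =
      ∑ j ∈ Finset.Icc (a + 1) k, fracKernel α ((k - j : ℤ) : ℝ) := by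
    refine Finset.sum_bij' (fun j _ => j + 1) (fun j _ => j - 1) ?_ ?_ ?_ ?_ ?_
    · intro j hj
      simp only [Finset.mem_Icc] at hj ⊢
      omega
    · intro j hj
      simp only [Finset.mem_Icc] at hj ⊢
      omega
    · simp
    · simp
    · intro j _
      congr 2
      ring
  simp only [nablaRL_eq_fracKernel, mul_one]
  rw [h, sub_nonneg]
  refine Finset.sum_le_sum_of_subset_of_nonneg (Finset.Icc_subset_Icc_left (by omega)) ?_
  intro j hj _
  refine fracKernel_nonneg hα1 ?_
  exact_mod_cast sub_nonneg.2 (Finset.mem_Icc.1 hj).2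

/-- A fractional difference obeys the chain-rule inequality at any tangent line of slope `s`
whose value at the origin is nonpositive. -/
theorem nablaRL_comp_le {α : ℝ} (hα0 : 0 < α) (hα1 : α < 1) {a k : ℤ} (hk : a ≤ k)
    (x : ℤ → ℝ) {φ : ℝ → ℝ} {s : ℝ} (htangent : ∀ u, φ (x k) + s * (u - x k) ≤ φ u)
    (horigin : φ (x k) ≤ s * x k) :
    nablaRL α a (fun j => φ (x j)) k ≤ s * nablaRL α a x k := by
  have hone := nablaRL_one_nonneg hα1 a k
  rw [nablaRL_eq_sub_sum hα1 hk] at hone ⊢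
  rw [nablaRL_eq_sub_sum hα1 hk x]
  set c : ℤ → ℝ := fun j =>
    fracKernel α ((k - 1 - j : ℤ) : ℝ) - fracKernel α ((k - j : ℤ) : ℝ) with hc
  have hc_nonneg : ∀ j ∈ Finset.Icc a (k - 1), 0 ≤ c j := by
    intro j hj
    have hj' : (0 : ℝ) ≤ ((k - 1 - j : ℤ) : ℝ) := by
      exact_mod_cast sub_nonneg.2 (Finset.mem_Icc.1 hj).2
    have h := fracKernel_add_one_le hα0 hα1 hj'
    rw [show ((k - 1 - j : ℤ) : ℝ) + 1 = ((k - j : ℤ) : ℝ) by push_cast; ring] at h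
    exact sub_nonneg.2 h
  have hsum : ∑ j ∈ Finset.Icc a (k - 1), c j * (φ (x k) + s * (x j - x k)) ≤
      ∑ j ∈ Finset.Icc a (k - 1), c j * φ (x j) :=
    Finset.sum_le_sum fun j hj => mul_le_mul_of_nonneg_left (htangent _) (hc_nonneg j hj)
  have hlin : ∑ j ∈ Finset.Icc a (k - 1), c j * (φ (x k) + s * (x j - x k)) =
      (∑ j ∈ Finset.Icc a (k - 1), c j * 1) * (φ (x k) - s * x k) +
        s * ∑ j ∈ Finset.Icc a (k - 1), c j * x j := by
    rw [Finset.sum_mul, Finset.mul_sum, ← Finset.sum_add_distrib]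
    exact Finset.sum_congr rfl fun j _ => by ring
  nlinarith [mul_nonneg hone (sub_nonneg.2 horigin)]

theorem pow_two_pow_tangent_le (m : ℕ) (u v : ℝ) :
    v ^ 2 ^ m + 2 ^ m * v ^ (2 ^ m - 1) * (u - v) ≤ u ^ 2 ^ m := by
  induction m generalizing u v with
  | zero => simp
  | succ m ih =>
    obtain ⟨n, hn⟩ : ∃ n, 2 ^ m = n + 1 := ⟨2 ^ m - 1, by have := Nat.two_pow_pos m; omega⟩
    have h := ih (u ^ 2) (v ^ 2)
    have hn' : 2 ^ (m + 1) - 1 = 2 * n + 1 := by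
      rw [pow_succ]
      omega
    rw [hn']
    rw [show 2 ^ m - 1 = n by omega] at h
    rw [show 2 ^ (m + 1) = 2 * 2 ^ m from pow_succ' 2 m, pow_mul, pow_mul]
    have hcoef : (0 : ℝ) ≤ 2 ^ m * (v ^ 2) ^ n := by positivity
    calc _ = (v ^ 2) ^ 2 ^ m + 2 ^ m * (v ^ 2) ^ n * (2 * v * (u - v)) := by ring
      _ ≤ (v ^ 2) ^ 2 ^ m + 2 ^ m * (v ^ 2) ^ n * (u ^ 2 - v ^ 2) := by
        gcongr
        nlinarith [sq_nonneg (u - v)]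
      _ ≤ _ := h

theorem nablaR_pow_two_pow (α : ℝ) (hα0 : 0 < α) (hα1 : α < 1) (a : ℤ)
    (m : ℕ) (hm : 0 < m) (x : ℤ → ℝ) (k : ℤ) (hk : a ≤ k) :
    nablaRL α a (fun j => x j ^ (2 ^ m)) k ≤
      (2 : ℝ) ^ m * x k ^ (2 ^ m - 1) * nablaRL α a x k := by
  refine nablaRL_comp_le hα0 hα1 hk x (φ := fun u => u ^ 2 ^ m)
    (fun u => pow_two_pow_tangent_le m u (x k)) ?_
  have h := pow_two_pow_tangent_le m 0 (x k)
  rw [zero_pow (by positivity)] at h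
  linarith
end

section
/- Let α ∈ (0,1), let a be an integer, let m be a positive integer, and let x : ℤ → ℝ. Then for every integer k ≥ a, ᴳ∇ᵃ_k^α (x^{2m}) ≤ 2·x(k)^m · ᴳ∇ᵃ_k^α (x^m), where x^p denotes the function j ↦ x(j)^p. -/
noncomputable def nablaGL (α : ℝ) (a : ℤ) (f : ℤ → ℝ) (k : ℤ) : ℝ :=
  ∑ j ∈ Finset.Icc (0 : ℤ) (k - a),
    Real.Gamma ((j : ℝ) - α) / (Real.Gamma (-α) * Real.Gamma ((j : ℝ) + 1)) * f (k - j)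

theorem sum_nablaGL_coeff (α : ℝ) (hα0 : 0 < α) (hα1 : α < 1) (n : ℕ) :
    ∑ j ∈ Finset.Icc (0 : ℤ) n,
      Real.Gamma ((j : ℝ) - α) / (Real.Gamma (-α) * Real.Gamma ((j : ℝ) + 1)) =
    Real.Gamma (n + 1 - α) / (Real.Gamma (1 - α) * Real.Gamma (n + 1)) := by
  have hΓ : Real.Gamma (1 - α) = -α * Real.Gamma (-α) := by
    rw [← Real.Gamma_add_one (by linarith)]
    ring_nf
  have hpos : 0 < Real.Gamma (1 - α) := Real.Gamma_pos_of_pos (by linarith)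
  have hne : Real.Gamma (-α) ≠ 0 := by
    intro h
    simp [hΓ, h] at hpos
  induction n with
  | zero => simp [hne, hpos.ne']
  | succ n ih =>
    have hIcc : Finset.Icc (0 : ℤ) ((n + 1 : ℕ) : ℤ) =
        insert ((n : ℤ) + 1) (Finset.Icc (0 : ℤ) n) := by
      ext i
      simp only [Finset.mem_Icc, Finset.mem_insert]
      omega
    have hn : (0 : ℝ) ≤ n := n.cast_nonneg
    have h₁ : Real.Gamma ((n : ℝ) + 1 + 1 - α) = (n + 1 - α) * Real.Gamma (n + 1 - α) := by
      rw [← Real.Gamma_add_one (by linarith)]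
      ring_nf
    have h₂ : Real.Gamma ((n : ℝ) + 1 + 1) = (n + 1) * Real.Gamma (n + 1) :=
      Real.Gamma_add_one (by positivity)
    have h₃ : Real.Gamma ((n : ℝ) + 1) ≠ 0 := (Real.Gamma_pos_of_pos (by positivity)).ne'
    have h₄ : (n : ℝ) + 1 ≠ 0 := by positivity
    rw [hIcc, Finset.sum_insert (by simp), ih]
    push_cast
    rw [h₁, h₂, hΓ]
    field_simp
    ring

theorem nablaGL_coeff_nonpos (α : ℝ) (hα0 : 0 < α) (hα1 : α < 1) {j : ℤ} (hj : 1 ≤ j) :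
    Real.Gamma ((j : ℝ) - α) / (Real.Gamma (-α) * Real.Gamma ((j : ℝ) + 1)) ≤ 0 := by
  have hj' : (1 : ℝ) ≤ j := by exact_mod_cast hj
  have hpos : 0 < Real.Gamma (-α + 1) := Real.Gamma_pos_of_pos (by linarith)
  rw [Real.Gamma_add_one (by linarith)] at hpos
  have hneg : Real.Gamma (-α) < 0 := by nlinarith
  exact div_nonpos_of_nonneg_of_nonpos (Real.Gamma_pos_of_pos (by linarith)).le
    (mul_nonpos_of_nonpos_of_nonneg hneg.le (Real.Gamma_pos_of_pos (by linarith)).le)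

theorem nablaG_pow_two_mul (α : ℝ) (hα0 : 0 < α) (hα1 : α < 1) (a : ℤ)
    (m : ℕ) (hm : 0 < m) (x : ℤ → ℝ) (k : ℤ) (hk : a ≤ k) :
    nablaGL α a (fun j => x j ^ (2 * m)) k ≤ 2 * x k ^ m * nablaGL α a (fun j => x j ^ m) k := by
  unfold nablaGL
  obtain ⟨n, hn⟩ := Int.eq_ofNat_of_zero_le (sub_nonneg.mpr hk)
  rw [hn]
  have hsum : 0 ≤ ∑ j ∈ Finset.Icc (0 : ℤ) n,
      Real.Gamma ((j : ℝ) - α) / (Real.Gamma (-α) * Real.Gamma ((j : ℝ) + 1)) := by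
    rw [sum_nablaGL_coeff α hα0 hα1]
    have hn : (0 : ℝ) ≤ n := n.cast_nonneg
    exact div_nonneg (Real.Gamma_pos_of_pos (by linarith)).le
      (mul_nonneg (Real.Gamma_pos_of_pos (by linarith)).le
        (Real.Gamma_pos_of_pos (by linarith)).le)
  rw [← sub_nonneg, Finset.mul_sum, ← Finset.sum_sub_distrib]
  refine (mul_nonneg hsum (sq_nonneg (x k ^ m))).trans ?_
  rw [Finset.sum_mul]
  refine Finset.sum_le_sum fun j hj => ?_
  simp only [mul_comm 2 m, pow_mul]
  rcases (Finset.mem_Icc.mp hj).1.eq_or_lt with rfl | hj0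
  · rw [sub_zero]
    exact le_of_eq (by ring)
  · nlinarith [mul_nonneg (neg_nonneg.mpr (nablaGL_coeff_nonpos α hα0 hα1 hj0))
      (sq_nonneg (x k ^ m - x (k - j) ^ m))]
end

section
/- Let α ∈ (0,1), let a be an integer, let m, n be positive integers with 2m > n, and let x : ℤ → ℝ. Then for every integer k ≥ a, ᴳ∇ᵃ_k^α (x^{2m}) ≤ (2m/(2m−n)) · x(k)^n · ᴳ∇ᵃ_k^α (x^{2m−n}), where x^p denotes the function j ↦ x(j)^p. -/
/-- The coefficient of `f (k - j)` in the nabla Grünwald–Letnikov difference of order `α`. -/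
noncomputable def glWeight (α : ℝ) (j : ℤ) : ℝ :=
  Real.Gamma ((j : ℝ) - α) / (Real.Gamma (-α) * Real.Gamma ((j : ℝ) + 1))

lemma nablaGL_eq_sum_glWeight (α : ℝ) (a : ℤ) (f : ℤ → ℝ) (k : ℤ) :
    nablaGL α a f k = ∑ j ∈ Finset.Icc (0 : ℤ) (k - a), glWeight α j * f (k - j) := rfl

lemma Gamma_one_sub_eq_neg_mul {α : ℝ} (hα : α ≠ 0) :
    Real.Gamma (1 - α) = -α * Real.Gamma (-α) := by
  rw [← Real.Gamma_add_one (neg_ne_zero.mpr hα)]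
  ring_nf

lemma Gamma_neg_lt_zero {α : ℝ} (hα0 : 0 < α) (hα1 : α < 1) : Real.Gamma (-α) < 0 := by
  have h := Real.Gamma_pos_of_pos (sub_pos.mpr hα1)
  rw [Gamma_one_sub_eq_neg_mul hα0.ne'] at h
  nlinarith

lemma glWeight_nonpos {α : ℝ} (hα0 : 0 < α) (hα1 : α < 1) {j : ℤ} (hj : 1 ≤ j) :
    glWeight α j ≤ 0 := by
  have hj' : (1 : ℝ) ≤ j := by exact_mod_cast hj
  exact div_nonpos_of_nonneg_of_nonpos (Real.Gamma_pos_of_pos (by linarith)).le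
    (mul_neg_of_neg_of_pos (Gamma_neg_lt_zero hα0 hα1)
      (Real.Gamma_pos_of_pos (by linarith))).le

lemma sum_glWeight {α : ℝ} (hα0 : 0 < α) (hα1 : α < 1) (N : ℕ) :
    ∑ j ∈ Finset.Icc (0 : ℤ) N, glWeight α j =
      Real.Gamma (N + 1 - α) / (Real.Gamma (1 - α) * Real.Gamma (N + 1)) := by
  have hneg := (Gamma_neg_lt_zero hα0 hα1).ne
  have hone := (Real.Gamma_pos_of_pos (sub_pos.mpr hα1)).ne'
  induction N with
  | zero => simp [glWeight, hneg, hone]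
  | succ N ih =>
    have hIcc : Finset.Icc (0 : ℤ) ((N + 1 : ℕ) : ℤ) =
        insert ((N : ℤ) + 1) (Finset.Icc (0 : ℤ) N) := by
      ext; simp only [Finset.mem_Icc, Finset.mem_insert]; omega
    have hN : (0 : ℝ) < N + 1 := by positivity
    have hstep : Real.Gamma ((N : ℝ) + 1 + 1 - α) =
        (N + 1 - α) * Real.Gamma (N + 1 - α) := by
      rw [← Real.Gamma_add_one (by linarith)]
      ring_nf
    have hfac := (Real.Gamma_pos_of_pos hN).ne'
    rw [hIcc, Finset.sum_insert (by simp), ih, glWeight]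
    push_cast
    rw [hstep, Real.Gamma_add_one hN.ne', Gamma_one_sub_eq_neg_mul hα0.ne']
    field_simp
    ring

lemma sum_glWeight_nonneg {α : ℝ} (hα0 : 0 < α) (hα1 : α < 1) (N : ℕ) :
    0 ≤ ∑ j ∈ Finset.Icc (0 : ℤ) N, glWeight α j := by
  have hN : (0 : ℝ) ≤ N := N.cast_nonneg
  rw [sum_glWeight hα0 hα1]
  exact div_nonneg (Real.Gamma_pos_of_pos (by linarith)).le
    (mul_pos (Real.Gamma_pos_of_pos (by linarith)) (Real.Gamma_pos_of_pos (by linarith))).le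

/-- Young's inequality for natural exponents with even sum. -/
lemma add_mul_pow_mul_pow_le_s14 {n q : ℕ} (hpos : 0 < n + q) (heven : Even (n + q)) (X y : ℝ) :
    ((n : ℝ) + q) * (X ^ n * y ^ q) ≤ n * X ^ (n + q) + q * y ^ (n + q) := by
  have hp : (0 : ℝ) < n + q := by exact_mod_cast hpos
  have hroot (t : ℝ) (r : ℕ) :
      (|t| ^ (n + q)) ^ ((r : ℝ) / (n + q)) = |t| ^ r := by
    rw [← Real.rpow_natCast, ← Real.rpow_mul (abs_nonneg t), ← Real.rpow_natCast |t| r]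
    congr 1
    push_cast
    field_simp
  have h := Real.geom_mean_le_arith_mean2_weighted (w₁ := n / (n + q)) (w₂ := q / (n + q))
    (by positivity) (by positivity) (pow_nonneg (abs_nonneg X) (n + q))
    (pow_nonneg (abs_nonneg y) (n + q)) (by field_simp)
  rw [hroot, hroot, heven.pow_abs, heven.pow_abs] at h
  have habs : X ^ n * y ^ q ≤ |X| ^ n * |y| ^ q := by
    rw [← abs_pow, ← abs_pow, ← abs_mul]
    exact le_abs_self _
  calc ((n : ℝ) + q) * (X ^ n * y ^ q)
      ≤ (n + q) * (n / (n + q) * X ^ (n + q) + q / (n + q) * y ^ (n + q)) :=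
        mul_le_mul_of_nonneg_left (habs.trans h) hp.le
    _ = n * X ^ (n + q) + q * y ^ (n + q) := by field_simp

/-- If `g` is minimal at `k`, with nonpositive minimum, then its
fractional difference at `k` is nonpositive. -/
lemma nablaGL_nonpos {α : ℝ} (hα0 : 0 < α) (hα1 : α < 1) {a k : ℤ} (hk : a ≤ k) {g : ℤ → ℝ}
    (hmin : ∀ j, g k ≤ g j) (hg : g k ≤ 0) : nablaGL α a g k ≤ 0 := by
  obtain ⟨N, hN⟩ := Int.eq_ofNat_of_zero_le (sub_nonneg.mpr hk)
  rw [nablaGL_eq_sum_glWeight, hN]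
  calc ∑ j ∈ Finset.Icc (0 : ℤ) N, glWeight α j * g (k - j)
      ≤ ∑ j ∈ Finset.Icc (0 : ℤ) N, glWeight α j * g k := by
        refine Finset.sum_le_sum fun j hj => ?_
        rcases (Finset.mem_Icc.mp hj).1.eq_or_lt with rfl | hpos
        · simp
        · exact mul_le_mul_of_nonpos_left (hmin _) (glWeight_nonpos hα0 hα1 hpos)
    _ = (∑ j ∈ Finset.Icc (0 : ℤ) N, glWeight α j) * g k := (Finset.sum_mul ..).symm
    _ ≤ 0 := mul_nonpos_of_nonneg_of_nonpos (sum_glWeight_nonneg hα0 hα1 N) hg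

lemma nablaGL_sub_const_mul (α : ℝ) (a k : ℤ) (c : ℝ) (f g : ℤ → ℝ) :
    nablaGL α a (fun j => f j - c * g j) k = nablaGL α a f k - c * nablaGL α a g k := by
  simp only [nablaGL_eq_sum_glWeight, Finset.mul_sum, ← Finset.sum_sub_distrib]
  exact Finset.sum_congr rfl fun _ _ => by ring

theorem nablaG_pow_ineq_two (α : ℝ) (hα0 : 0 < α) (hα1 : α < 1) (a : ℤ)
    (m n : ℕ) (hm : 0 < m) (hn : 0 < n) (hmn : n < 2 * m) (x : ℤ → ℝ) (k : ℤ) (hk : a ≤ k) :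
    nablaGL α a (fun j => x j ^ (2 * m)) k ≤
      (2 * m : ℝ) / ((2 * m : ℝ) - (n : ℝ)) * x k ^ n * nablaGL α a (fun j => x j ^ (2 * m - n)) k := by
  obtain ⟨q, hq⟩ := Nat.exists_eq_add_of_lt hmn
  have hsum : 2 * m = n + (q + 1) := by omega
  have hcast : (2 * m : ℝ) = n + (q + 1 : ℕ) := by exact_mod_cast hsum
  have heven : Even (n + (q + 1)) := hsum ▸ even_two_mul m
  have hq0 : (0 : ℝ) < (q + 1 : ℕ) := by positivity
  rw [hcast, hsum, Nat.add_sub_cancel_left, add_sub_cancel_left, ← sub_nonpos,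
    ← nablaGL_sub_const_mul]
  generalize q + 1 = r at *
  have hval : x k ^ (n + r) - (n + r : ℝ) / r * x k ^ n * x k ^ r = -(n / r * x k ^ (n + r)) := by
    rw [pow_add]
    field_simp
    ring
  refine nablaGL_nonpos hα0 hα1 hk (fun j => ?_) ?_
  · have hyoung := add_mul_pow_mul_pow_le_s14 (by omega) heven (x k) (x j)
    rw [hval, ← sub_nonneg]
    have hdiff : x j ^ (n + r) - (n + r : ℝ) / r * x k ^ n * x j ^ r - -(n / r * x k ^ (n + r)) =
        (n * x k ^ (n + r) + r * x j ^ (n + r) - (n + r) * (x k ^ n * x j ^ r)) / r := by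
      field_simp
      ring
    rw [hdiff]
    exact div_nonneg (sub_nonneg.mpr hyoung) hq0.le
  · rw [hval, neg_nonpos]
    exact mul_nonneg (by positivity) (heven.pow_nonneg _)
end

section
/- Let α ∈ (0,1), let a be an integer, and let f : ℤ → ℝ. Then for every integer k ≥ a, the Riemann–Liouville and Caputo fractional differences are related by ᴿ∇ᵃ_k^α f = ᶜ∇ᵃ_k^α f + [Γ(k−a+1−α) / (Γ(1−α)·Γ(k−a+1))] · f(a−1). -/
theorem nablaRL_eq_nablaCaputo_add (α : ℝ) (hα0 : 0 < α) (hα1 : α < 1) (a : ℤ)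
    (f : ℤ → ℝ) (k : ℤ) (hk : a ≤ k) :
    nablaRL α a f k = nablaCaputo α a f k +
      Real.Gamma (((k - a : ℤ) : ℝ) + 1 - α) /
        (Real.Gamma (1 - α) * Real.Gamma (((k - a : ℤ) : ℝ) + 1)) * f (a - 1) := by
  have hshift : ∑ j ∈ Finset.Icc a k,
      Real.Gamma (((k - j : ℤ) : ℝ) + 1 - α) /
        (Real.Gamma (1 - α) * Real.Gamma (((k - j : ℤ) : ℝ) + 1)) * f (j - 1) =
      ∑ i ∈ Finset.Icc (a - 1) (k - 1),
        Real.Gamma (((k - i : ℤ) : ℝ) - α) /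
          (Real.Gamma (1 - α) * Real.Gamma (((k - i : ℤ) : ℝ))) * f i := by
    refine Finset.sum_bij (fun j _ => j - 1) ?_ ?_ ?_ ?_
    · intro j hj
      simp only [Finset.mem_Icc] at hj ⊢
      omega
    · intro i _ j _ h
      simpa using h
    · intro i hi
      simp only [Finset.mem_Icc] at hi
      exact ⟨i + 1, Finset.mem_Icc.mpr (by omega), by ring⟩
    · intro j _
      have h : ((k - (j - 1) : ℤ) : ℝ) = ((k - j : ℤ) : ℝ) + 1 := by push_cast; ring
      rw [h]
  have hsplit : Finset.Icc (a - 1) (k - 1) = insert (a - 1) (Finset.Icc a (k - 1)) := by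
    ext i
    simp only [Finset.mem_insert, Finset.mem_Icc]
    omega
  have hcast : ((k - (a - 1) : ℤ) : ℝ) = ((k - a : ℤ) : ℝ) + 1 := by push_cast; ring
  rw [hsplit, Finset.sum_insert (by simp), hcast] at hshift
  simp only [nablaRL, nablaCaputo, mul_sub, Finset.sum_sub_distrib]
  rw [hshift]
  ring
end
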